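/- arXiv:2006.14456 — 5 statements merged into one kernel-verified Lean document; each statement's English description precedes it below -/
import Mathlib

section
/- Let p ≥ 1 be a real number, m ≥ 1 an integer, and C ≥ 0 a real constant. For each j ∈ ℕ let s_j : ℕ≥1 → ℝ be a nonincreasing sequence of nonnegative reals such that ∑_{k=1}^∞ s_j(k)·k^{-1+1/p} ≤ C. If lim_{j→∞} s_j(1) = 0, then lim_{j→∞} ( ∑_{l=1}^∞ s_j(⌈l/m⌉)·l^{-1+1/p} − m^{1/p} · ∑_{k=1}^∞ s_j(k)·k^{-1+1/p} ) = 0 (all the series involved converge). -/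
theorem aux_D (a : ℝ) (ha : a ≤ 0) (m : ℕ) (hm : 1 ≤ m) :
    (∀ k : ℕ, 0 ≤ (∑ r : Fin m, ((k * m + r : ℕ) + 1 : ℝ) ^ a) - (m : ℝ) ^ (1 + a) * ((k : ℝ) + 1) ^ a) ∧
    ∀ n : ℕ, ∑ k ∈ Finset.range n, ((∑ r : Fin m, ((k * m + r : ℕ) + 1 : ℝ) ^ a)
      - (m : ℝ) ^ (1 + a) * ((k : ℝ) + 1) ^ a) ≤ m + (m : ℝ) ^ (1 + a) := by
  have hm0 : (0 : ℝ) < m := by exact_mod_cast hm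
  have hM : ∀ x : ℝ, 0 < x → (m : ℝ) ^ (1 + a) * x ^ a = ∑ r : Fin m, (m * x) ^ a := by
    intro x hx
    rw [Finset.sum_const, Finset.card_univ, Fintype.card_fin, nsmul_eq_mul,
      Real.mul_rpow hm0.le hx.le, Real.rpow_add hm0, Real.rpow_one]
    ring
  have hMpos : 0 ≤ (m : ℝ) ^ (1 + a) := by positivity
  constructor
  · intro k
    rw [hM _ (by positivity), sub_nonneg]
    refine Finset.sum_le_sum fun r _ => Real.rpow_le_rpow_of_nonpos (by positivity) ?_ ha
    have : ((r : ℕ) : ℝ) + 1 ≤ m := by exact_mod_cast r.2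
    push_cast
    nlinarith
  · have key : ∀ n : ℕ, ∑ k ∈ Finset.range (n + 1), ((∑ r : Fin m, ((k * m + r : ℕ) + 1 : ℝ) ^ a)
      - (m : ℝ) ^ (1 + a) * ((k : ℝ) + 1) ^ a)
        ≤ m + (m : ℝ) ^ (1 + a) - (m : ℝ) ^ (1 + a) * ((n : ℝ) + 1) ^ a := by
      intro n
      induction n with
      | zero =>
        rw [Finset.sum_range_one]
        have : ∑ r : Fin m, (((0 * m + r : ℕ) : ℝ) + 1) ^ a ≤ ∑ r : Fin m, (1 : ℝ) :=
          Finset.sum_le_sum fun r _ => Real.rpow_le_one_of_one_le_of_nonpos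
            (by have : (0 : ℝ) ≤ ((0 * m + r : ℕ) : ℝ) := by positivity
                linarith) ha
        simp only [Finset.sum_const, Finset.card_univ, Fintype.card_fin, nsmul_eq_mul, mul_one] at this
        linarith
      | succ n ih =>
        rw [Finset.sum_range_succ]
        have : ∑ r : Fin m, ((((n + 1) * m + r : ℕ) : ℝ) + 1) ^ a
            ≤ (m : ℝ) ^ (1 + a) * ((n : ℝ) + 1) ^ a := by
          rw [hM _ (by positivity)]
          refine Finset.sum_le_sum fun r _ => Real.rpow_le_rpow_of_nonpos (by positivity) ?_ ha
          have : (0 : ℝ) ≤ ((r : ℕ) : ℝ) := by positivity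
          push_cast
          nlinarith
        linarith
    intro n
    cases n with
    | zero => simp; positivity
    | succ n =>
      have : 0 ≤ (m : ℝ) ^ (1 + a) * ((n : ℝ) + 1) ^ a := by positivity
      linarith [key n]

theorem aux_one (a : ℝ) (ha : a ≤ 0) (m : ℕ) (hm : 1 ≤ m) (s : ℕ → ℝ)
    (hnonneg : ∀ k, 1 ≤ k → 0 ≤ s k) (hmono : ∀ k, 1 ≤ k → s (k + 1) ≤ s k)
    (hs : Summable (fun k : ℕ => s (k + 1) * ((k + 1 : ℝ)) ^ a)) :
    Summable (fun l : ℕ => s ((l + m) / m) * ((l + 1 : ℝ)) ^ a) ∧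
    0 ≤ (∑' l : ℕ, s ((l + m) / m) * ((l + 1 : ℝ)) ^ a) -
            (m : ℝ) ^ (1 + a) * ∑' k : ℕ, s (k + 1) * ((k + 1 : ℝ)) ^ a ∧
    (∑' l : ℕ, s ((l + m) / m) * ((l + 1 : ℝ)) ^ a) -
            (m : ℝ) ^ (1 + a) * ∑' k : ℕ, s (k + 1) * ((k + 1 : ℝ)) ^ a
      ≤ s 1 * (m + (m : ℝ) ^ (1 + a)) := by
  obtain ⟨hD0, hDs⟩ := aux_D a ha m hm
  set D : ℕ → ℝ := fun k => (∑ r : Fin m, ((k * m + r : ℕ) + 1 : ℝ) ^ a)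
      - (m : ℝ) ^ (1 + a) * ((k : ℝ) + 1) ^ a with hD
  have hD0' : ∀ k, 0 ≤ D k := hD0
  have hDsum : Summable D := summable_of_sum_range_le hD0 hDs
  have hDt : ∑' k, D k ≤ m + (m : ℝ) ^ (1 + a) := Real.tsum_le_of_sum_range_le hD0 hDs
  have hs1 : ∀ k, s (k + 1) ≤ s 1 := by
    intro k
    induction k with
    | zero => exact le_rfl
    | succ k ih => exact (hmono (k + 1) (by omega)).trans ih
  have hsD0 : ∀ k, 0 ≤ s (k + 1) * D k := fun k => mul_nonneg (hnonneg _ (by omega)) (hD0' k)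
  have hsDle : ∀ k, s (k + 1) * D k ≤ s 1 * D k := fun k =>
    mul_le_mul_of_nonneg_right (hs1 k) (hD0' k)
  have hsD : Summable fun k => s (k + 1) * D k :=
    Summable.of_nonneg_of_le hsD0 hsDle (hDsum.mul_left _)
  haveI : NeZero m := ⟨by omega⟩
  let e := (Nat.divModEquiv m).symm
  have he : ∀ (q : ℕ) (r : Fin m), e (q, r) = q * m + r := fun q r => by
    simp [e, Nat.divModEquiv]
  set f : ℕ → ℝ := fun l : ℕ => s ((l + m) / m) * ((l + 1 : ℝ)) ^ a with hf
  have hfe : ∀ (q : ℕ) (r : Fin m), f (e (q, r)) = s (q + 1) * ((q * m + r : ℕ) + 1 : ℝ) ^ a := by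
    intro q r
    rw [he]
    have : (q * m + r + m) / m = q + 1 := by
      rw [show q * m + r + m = r + (q + 1) * m by ring, Nat.add_mul_div_right _ _ (by omega),
        Nat.div_eq_of_lt r.2, zero_add]
    simp only [hf, this]
  have hblock : ∀ q : ℕ, ∑' r : Fin m, f (e (q, r)) =
      s (q + 1) * D q + (m : ℝ) ^ (1 + a) * (s (q + 1) * ((q + 1 : ℝ)) ^ a) := by
    intro q
    rw [tsum_fintype]
    simp only [hfe]
    rw [← Finset.mul_sum]
    simp only [hD]
    ring
  have hbs := hsD.add (hs.mul_left ((m : ℝ) ^ (1 + a)))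
  have hS : Summable (f ∘ e) := by
    rw [summable_prod_of_nonneg]
    · refine ⟨fun q => (hasSum_fintype _).summable, ?_⟩
      simp only [Function.comp, hblock]
      exact hbs
    · rintro ⟨q, r⟩
      simp only [Function.comp, hfe]
      exact mul_nonneg (hnonneg _ (by omega)) (by positivity)
  have hsumf : Summable f := e.summable_iff.1 hS
  have htf : ∑' l, f l = ∑' k, s (k + 1) * D k +
      (m : ℝ) ^ (1 + a) * ∑' k : ℕ, s (k + 1) * ((k + 1 : ℝ)) ^ a := by
    rw [← e.tsum_eq f, Summable.tsum_prod (f := fun x => f (e x)) hS]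
    simp only [hblock]
    rw [hsD.tsum_add (hs.mul_left _), tsum_mul_left]
  refine ⟨hsumf, ?_, ?_⟩
  · rw [htf, add_sub_cancel_right]
    exact tsum_nonneg hsD0
  · rw [htf, add_sub_cancel_right]
    calc _ ≤ ∑' k, s 1 * D k := hsD.tsum_le_tsum hsDle (hDsum.mul_left _)
      _ = s 1 * ∑' k, D k := tsum_mul_left
      _ ≤ _ := mul_le_mul_of_nonneg_left hDt (hnonneg 1 le_rfl)

/-- Lemma 3.1 of the paper, in singular-value-sequence form.
`s j k` represents the `k`-th singular value `s_j(k)` (for `k ≥ 1`) of `X_j`;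
the singular values of the ampliation `X_j ⊗ I_m` repeat each value `m` times,
so its `l`-th singular value (`l ≥ 1`) is `s j ⌈l/m⌉`, and for `l ≥ 1` we have
`⌈l/m⌉ = (l + m - 1)/m` in natural-number division. -/
theorem stmt_0 (p : ℝ) (hp : 1 ≤ p) (m : ℕ) (hm : 1 ≤ m) (C : ℝ) (hC : 0 ≤ C)
    (s : ℕ → ℕ → ℝ)
    (hnonneg : ∀ j k, 1 ≤ k → 0 ≤ s j k)
    (hmono : ∀ j k, 1 ≤ k → s j (k + 1) ≤ s j k)
    (hsummable : ∀ j, Summable (fun k : ℕ => s j (k + 1) * ((k + 1 : ℝ)) ^ (-1 + 1 / p)))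
    (hbound : ∀ j, (∑' k : ℕ, s j (k + 1) * ((k + 1 : ℝ)) ^ (-1 + 1 / p)) ≤ C)
    (hlim : Filter.Tendsto (fun j => s j 1) Filter.atTop (nhds 0)) :
    (∀ j, Summable (fun l : ℕ => s j ((l + m) / m) * ((l + 1 : ℝ)) ^ (-1 + 1 / p))) ∧
      Filter.Tendsto
        (fun j =>
          (∑' l : ℕ, s j ((l + m) / m) * ((l + 1 : ℝ)) ^ (-1 + 1 / p)) -
            (m : ℝ) ^ (1 / p) * ∑' k : ℕ, s j (k + 1) * ((k + 1 : ℝ)) ^ (-1 + 1 / p))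
        Filter.atTop (nhds 0) := by
  have ha : -1 + 1 / p ≤ 0 := by
    have : 1 / p ≤ 1 := by
      rw [div_le_one (by linarith)]
      exact hp
    linarith
  have h := fun j => aux_one (-1 + 1 / p) ha m hm (s j) (hnonneg j) (hmono j) (hsummable j)
  rw [show 1 + (-1 + 1 / p) = 1 / p by ring] at h
  refine ⟨fun j => (h j).1, squeeze_zero (fun j => (h j).2.1) (fun j => (h j).2.2) ?_⟩
  simpa using hlim.mul_const ((m : ℝ) + (m : ℝ) ^ (1 / p))
end

section
/- Let p ≥ 1 be real, m ≥ 1 an integer, and s : ℕ≥1 → [0,∞) any sequence of nonnegative reals. Then, as an inequality of sums in the extended nonnegative reals, ∑_{l=1}^∞ s(⌈l/m⌉) · l^{-1+1/p} ≥ m^{1/p} · ∑_{k=1}^∞ s(k) · k^{-1+1/p}. -/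
open scoped NNReal ENNReal

/-- The first display in the proof of Lemma 3.1, in singular-value-sequence form,
as an inequality of sums in `ℝ≥0∞`. Here `s k` represents `s(k)` for `k ≥ 1`,
and for `l ≥ 1` the ceiling `⌈l/m⌉` equals `(l + m - 1)/m` in natural-number division. -/
theorem stmt_3 (p : ℝ) (hp : 1 ≤ p) (m : ℕ) (hm : 1 ≤ m) (s : ℕ → ℝ≥0) :
    ENNReal.ofReal ((m : ℝ) ^ (1 / p)) *
        ∑' k : ℕ, (s (k + 1) : ℝ≥0∞) * ENNReal.ofReal ((k + 1 : ℝ) ^ (-1 + 1 / p)) ≤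
      ∑' l : ℕ, (s ((l + m) / m) : ℝ≥0∞) * ENNReal.ofReal ((l + 1 : ℝ) ^ (-1 + 1 / p)) := by
  have : NeZero m := ⟨by omega⟩
  have hm0 : (0 : ℝ) < m := by exact_mod_cast hm
  have hneg : -1 + 1 / p ≤ 0 := by
    have : 1 / p ≤ 1 := by
      rw [div_le_one (by linarith)]
      exact hp
    linarith
  rw [← ENNReal.tsum_mul_left, ← (Nat.divModEquiv m).symm.tsum_eq
    (fun l : ℕ => (s ((l + m) / m) : ℝ≥0∞) * ENNReal.ofReal ((l + 1 : ℝ) ^ (-1 + 1 / p))),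
    ENNReal.tsum_prod']
  refine ENNReal.tsum_le_tsum fun k => ?_
  have hk0 : (0 : ℝ) < (k : ℝ) + 1 := by positivity
  have key : ENNReal.ofReal ((m : ℝ) ^ (1 / p)) *
      ((s (k + 1) : ℝ≥0∞) * ENNReal.ofReal ((k + 1 : ℝ) ^ (-1 + 1 / p))) =
      ∑' _ : Fin m, (s (k + 1) : ℝ≥0∞) *
        ENNReal.ofReal (((m : ℝ) * (k + 1 : ℝ)) ^ (-1 + 1 / p)) := by
    rw [tsum_fintype, Finset.sum_const, Finset.card_univ, Fintype.card_fin, nsmul_eq_mul,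
      Real.mul_rpow hm0.le hk0.le, ENNReal.ofReal_mul (by positivity)]
    have h1 : (m : ℝ) ^ (1 / p) = m * (m : ℝ) ^ (-1 + 1 / p) := by
      rw [Real.rpow_add hm0, Real.rpow_neg_one]
      field_simp
    rw [h1, ENNReal.ofReal_mul hm0.le, ENNReal.ofReal_natCast]
    ring
  rw [key]
  refine ENNReal.tsum_le_tsum fun r => ?_
  have hr := r.isLt
  have he : (Nat.divModEquiv m).symm (k, r) = k * m + r := by
    simp [Nat.divModEquiv]
  simp only [he]
  have hd : (k * m + (r : ℕ) + m) / m = k + 1 := by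
    rw [Nat.add_div_right _ (by omega), Nat.add_comm (k * m),
      Nat.add_mul_div_right _ _ (by omega), Nat.div_eq_of_lt hr]
    simp
  rw [hd]
  refine mul_le_mul_right (ENNReal.ofReal_le_ofReal ?_) _
  refine Real.rpow_le_rpow_of_nonpos (by positivity) ?_ hneg
  have : ((r : ℕ) : ℝ) + 1 ≤ m := by exact_mod_cast hr
  push_cast
  linarith
end

section
/- Let H be a complex Hilbert space, N ≥ 1 an integer, and X : Fin N → B(H) a family of bounded linear operators on H such that (X i)* ∘ (X j) = 0 and (X i) ∘ (X j)* = 0 whenever i ≠ j. Then ‖∑_{i} X i‖ = max_{i} ‖X i‖. -/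
lemma aux_pair {A : Type*} [CStarAlgebra A] (a b : A) (h₁ : star a * b = 0)
    (h₂ : a * star b = 0) : ‖a + b‖₊ = max ‖a‖₊ ‖b‖₊ := by
  have h₃ : star b * a = 0 := by simpa using congrArg star h₁
  have e : star (a + b) * (a + b) = star a * a + star b * b := by
    simp [add_mul, mul_add, h₁, h₃]
  have h0 : (star a * a) * (star b * b) = 0 := by
    rw [mul_assoc, ← mul_assoc a, h₂]; simp
  have key := (IsSelfAdjoint.star_mul_self a).norm_add_eq_max (IsSelfAdjoint.star_mul_self b) h0
  rw [← e] at key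
  simp only [CStarRing.norm_star_mul_self, ← pow_two] at key
  apply NNReal.eq
  push_cast
  have ha := norm_nonneg a
  have hb := norm_nonneg b
  refine (pow_left_inj₀ (norm_nonneg _) (le_max_of_le_left ha) two_ne_zero).1 ?_
  rw [key]
  rcases le_total ‖a‖ ‖b‖ with h | h
  · rw [max_eq_right h, max_eq_right (by gcongr)]
  · rw [max_eq_left h, max_eq_left (by gcongr)]

lemma aux_sum {A ι : Type*} [CStarAlgebra A] (X : ι → A)
    (h₁ : ∀ i j, i ≠ j → star (X i) * X j = 0)
    (h₂ : ∀ i j, i ≠ j → X i * star (X j) = 0) (s : Finset ι) :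
    ‖∑ i ∈ s, X i‖₊ = s.sup (fun i => ‖X i‖₊) := by
  classical
  induction s using Finset.induction with
  | empty => simp
  | insert j s hj ih =>
    rw [Finset.sum_insert hj, Finset.sup_insert, ← ih]
    refine aux_pair _ _ ?_ ?_
    · rw [Finset.mul_sum]
      exact Finset.sum_eq_zero fun i hi => h₁ _ _ (by grind)
    · rw [star_sum, Finset.mul_sum]
      exact Finset.sum_eq_zero fun i hi => h₂ _ _ (by grind)

/-- If bounded operators `X i` on a complex Hilbert space satisfy
`(X i)* ∘ (X j) = 0` and `(X i) ∘ (X j)* = 0` for `i ≠ j`, then the norm of their sum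
is the maximum of their norms. This underlies the estimate
`‖[τ, A_4 + ⋯ + A_{4N}]‖ ≤ 2‖τ‖` in the proof of Lemma 3.2. -/
theorem stmt_5 (H : Type*) [NormedAddCommGroup H] [InnerProductSpace ℂ H] [CompleteSpace H]
    (N : ℕ) (hN : 1 ≤ N) (X : Fin N → H →L[ℂ] H)
    (h₁ : ∀ i j : Fin N, i ≠ j → (ContinuousLinearMap.adjoint (X i)).comp (X j) = 0)
    (h₂ : ∀ i j : Fin N, i ≠ j → (X i).comp (ContinuousLinearMap.adjoint (X j)) = 0) :
    ‖∑ i : Fin N, X i‖ =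
      Finset.univ.sup' (Finset.univ_nonempty_iff.mpr ⟨⟨0, hN⟩⟩) (fun i => ‖X i‖) := by
  have key := aux_sum X h₁ h₂ Finset.univ
  have hne : (Finset.univ : Finset (Fin N)).Nonempty := Finset.univ_nonempty_iff.mpr ⟨⟨0, hN⟩⟩
  rw [← Finset.sup'_eq_sup hne] at key
  rw [← coe_nnnorm, key]
  exact Finset.comp_sup'_eq_sup'_comp hne (fun x : NNReal => (x : ℝ)) NNReal.coe_max
end

section
/- In the self-similar Cantor-type setting, the Hausdorff dimension of K equals log N / log(1/λ), i.e. dimH K = Real.log N / Real.log (1/λ). -/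
open MeasureTheory
open scoped ENNReal

/-- The contracting similarity `F i x = λ • (x - b i) + b i` of `EuclideanSpace ℝ (Fin n)`. -/
noncomputable def cantorMap (n N : ℕ) (lam : ℝ) (b : Fin N → EuclideanSpace ℝ (Fin n))
    (i : Fin N) (x : EuclideanSpace ℝ (Fin n)) : EuclideanSpace ℝ (Fin n) :=
  lam • (x - b i) + b i

/-- For a word `w = (w_1, …, w_L)`, the composition `F_w = F_{w_1} ∘ ⋯ ∘ F_{w_L}`. -/
noncomputable def cantorMapWord (n N : ℕ) (lam : ℝ) (b : Fin N → EuclideanSpace ℝ (Fin n))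
    (w : List (Fin N)) : EuclideanSpace ℝ (Fin n) → EuclideanSpace ℝ (Fin n) :=
  w.foldr (fun i g => cantorMap n N lam b i ∘ g) id

/-- The cell `K_w = F_w '' K` of the self-similar set `K`. -/
noncomputable def cantorCell (n N : ℕ) (lam : ℝ) (b : Fin N → EuclideanSpace ℝ (Fin n))
    (K : Set (EuclideanSpace ℝ (Fin n))) (w : List (Fin N)) :
    Set (EuclideanSpace ℝ (Fin n)) :=
  cantorMapWord n N lam b w '' K

open Filter Topology in
theorem aux_upper (n N : ℕ) (lam p : ℝ) (hlam0 : 0 < lam) (hlam1 : lam < 1) (hp : 0 < p)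
    (hlp : lam ^ p = (N : ℝ)⁻¹) (hN : 2 ≤ N)
    (b : Fin N → EuclideanSpace ℝ (Fin n))
    (K : Set (EuclideanSpace ℝ (Fin n))) (hKcpt : IsCompact K)
    (hself : K = ⋃ i : Fin N, cantorMap n N lam b i '' K)
    (hdist : ∀ i x y, dist (cantorMap n N lam b i x) (cantorMap n N lam b i y) = lam * dist x y) :
    dimH K ≤ ENNReal.ofReal p := by
  set D := Metric.diam K with hD
  have hD0 : 0 ≤ D := Metric.diam_nonneg
  have cover : ∀ L : ℕ, ∃ t : (Fin L → Fin N) → Set (EuclideanSpace ℝ (Fin n)),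
      (∀ w, Metric.ediam (t w) ≤ ENNReal.ofReal (lam ^ L * D)) ∧ K ⊆ ⋃ w, t w := by
    intro L
    induction L with
    | zero =>
      refine ⟨fun _ => K, fun w => ?_, ?_⟩
      · rw [pow_zero, one_mul, hD, Metric.diam, ENNReal.ofReal_toReal]
        exact hKcpt.isBounded.ediam_ne_top
      · intro x hx
        exact Set.mem_iUnion.2 ⟨Fin.elim0, hx⟩
    | succ L ih =>
      obtain ⟨t, ht, hK⟩ := ih
      refine ⟨fun w => cantorMap n N lam b (w 0) '' t (Fin.tail w), fun w => ?_, ?_⟩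
      · have hl : LipschitzWith (NNReal.mk lam hlam0.le) (cantorMap n N lam b (w 0)) :=
          LipschitzWith.of_dist_le_mul fun x y => (hdist _ x y).le
        refine (hl.ediam_image_le _).trans ?_
        have h1 : ((NNReal.mk lam hlam0.le) : ℝ≥0∞) = ENNReal.ofReal lam :=
          (ENNReal.ofReal_eq_coe_nnreal hlam0.le).symm
        rw [h1, pow_succ', mul_assoc, ENNReal.ofReal_mul hlam0.le]
        gcongr
        exact ht _
      · intro x hx
        rw [hself] at hx
        obtain ⟨i, y, hy, rfl⟩ := Set.mem_iUnion.1 hx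
        obtain ⟨w, hw⟩ := Set.mem_iUnion.1 (hK hy)
        refine Set.mem_iUnion.2 ⟨Fin.cons i w, ?_⟩
        simp only [Fin.cons_zero, Fin.tail_cons]
        exact ⟨y, hw, rfl⟩
  choose t ht hK using cover
  have hN0 : (N : ℝ) ≠ 0 := by positivity
  have hr : Tendsto (fun L : ℕ => ENNReal.ofReal (lam ^ L * D)) atTop (𝓝 0) := by
    have : Tendsto (fun L : ℕ => lam ^ L * D) atTop (𝓝 0) := by
      simpa using (tendsto_pow_atTop_nhds_zero_of_lt_one hlam0.le hlam1).mul_const D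
    simpa using ENNReal.tendsto_ofReal this
  have key := Measure.hausdorffMeasure_le_liminf_sum p K _ hr t
    (Eventually.of_forall ht) (Eventually.of_forall hK)
  have bound : ∀ L : ℕ, ∑ w, Metric.ediam (t L w) ^ p ≤ ENNReal.ofReal (D ^ p) := by
    intro L
    calc ∑ w, Metric.ediam (t L w) ^ p
        ≤ ∑ w : Fin L → Fin N, ENNReal.ofReal (((N : ℝ)⁻¹) ^ L * D ^ p) := by
          refine Finset.sum_le_sum fun w _ => ?_
          refine (ENNReal.rpow_le_rpow (ht L w) hp.le).trans ?_
          rw [ENNReal.ofReal_rpow_of_nonneg (by positivity) hp.le,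
            Real.mul_rpow (by positivity) hD0, ← hlp, ← Real.rpow_natCast, ← Real.rpow_natCast,
            ← Real.rpow_mul hlam0.le, ← Real.rpow_mul hlam0.le, mul_comm (L : ℝ)]
      _ = ENNReal.ofReal (D ^ p) := by
          rw [Finset.sum_const, Finset.card_univ, Fintype.card_fun, Fintype.card_fin,
            Fintype.card_fin, ← ENNReal.ofReal_nsmul]
          congr 1
          rw [nsmul_eq_mul, Nat.cast_pow, ← mul_assoc, ← mul_pow, mul_inv_cancel₀ hN0]
          simp
  have hfin : μH[p] K ≠ ∞ := by
    refine ne_top_of_le_ne_top ENNReal.ofReal_ne_top (key.trans (b := _) (c := ENNReal.ofReal (D ^ p)) ?_)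
    refine (liminf_le_liminf (Eventually.of_forall bound)).trans ?_
    simp
  have := dimH_le_of_hausdorffMeasure_ne_top (d := NNReal.mk p hp.le) (s := K) hfin
  refine this.trans ?_
  rw [ENNReal.ofReal_eq_coe_nnreal hp.le]

theorem aux_lower (n N : ℕ) (lam p : ℝ) (hlam0 : 0 < lam) (hlam1 : lam < 1) (hp : 0 < p)
    (hlp : lam ^ p = (N : ℝ)⁻¹) (hN : 2 ≤ N)
    (b : Fin N → EuclideanSpace ℝ (Fin n))
    (K : Set (EuclideanSpace ℝ (Fin n))) (hKne : K.Nonempty) (hKcpt : IsCompact K)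
    (hself : K = ⋃ i : Fin N, cantorMap n N lam b i '' K)
    (hdisj : ∀ i j : Fin N, i ≠ j →
      (cantorMap n N lam b i '' K) ∩ (cantorMap n N lam b j '' K) = ∅)
    (hdist : ∀ i x y, dist (cantorMap n N lam b i x) (cantorMap n N lam b i y) = lam * dist x y) :
    ENNReal.ofReal p ≤ dimH K := by
  have hN0 : (0 : ℝ) < N := by positivity
  have hcont : ∀ i, Continuous (cantorMap n N lam b i) := fun i => by
    unfold cantorMap; fun_prop
  have hinj : ∀ i, Function.Injective (cantorMap n N lam b i) := fun i x y h => by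
    have := hdist i x y
    rw [h, dist_self] at this
    rcases mul_eq_zero.1 this.symm with h | h
    · exact absurd h hlam0.ne'
    · exact dist_eq_zero.1 h
  have hmem : ∀ i, ∀ x ∈ K, cantorMap n N lam b i x ∈ K := fun i x hx => by
    rw [hself]
    exact Set.mem_iUnion.2 ⟨i, x, hx, rfl⟩
  -- separation
  obtain ⟨δ, hδ, hsep⟩ : ∃ δ : ℝ, 0 < δ ∧ ∀ i j, i ≠ j → ∀ x ∈ K, ∀ y ∈ K,
      δ ≤ dist (cantorMap n N lam b i x) (cantorMap n N lam b j y) := by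
    have h1 : ∀ q : Fin N × Fin N, ∃ r : ℝ, 0 < r ∧ (q.1 ≠ q.2 → ∀ x ∈ K, ∀ y ∈ K,
        r ≤ dist (cantorMap n N lam b q.1 x) (cantorMap n N lam b q.2 y)) := by
      rintro ⟨i, j⟩
      by_cases hij : i = j
      · exact ⟨1, one_pos, fun h => absurd hij h⟩
      · obtain ⟨r, hr, h⟩ := Metric.exists_pos_forall_lt_edist (hKcpt.image (hcont i))
          (hKcpt.image (hcont j)).isClosed (Set.disjoint_iff_inter_eq_empty.2 (hdisj i j hij))
        refine ⟨r, hr, fun _ x hx y hy => ?_⟩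
        have := h _ ⟨x, hx, rfl⟩ _ ⟨y, hy, rfl⟩
        rw [edist_nndist] at this
        exact_mod_cast this.le
    choose r hr h using h1
    have : Nonempty (Fin N × Fin N) := ⟨(⟨0, by omega⟩, ⟨0, by omega⟩)⟩
    obtain ⟨q, hq⟩ := Finite.exists_min r
    exact ⟨r q, hr q, fun i j hij x hx y hy => (hq (i, j)).trans (h (i, j) hij x hx y hy)⟩
  -- coding
  have hcode : ∀ x, ∃ q : Fin N × EuclideanSpace ℝ (Fin n),
      x ∈ K → q.2 ∈ K ∧ cantorMap n N lam b q.1 q.2 = x := by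
    intro x
    by_cases hx : x ∈ K
    · have hx' := hx
      rw [hself] at hx'
      obtain ⟨i, y, hy, h⟩ := Set.mem_iUnion.1 hx'
      exact ⟨(i, y), fun _ => ⟨hy, h⟩⟩
    · exact ⟨(⟨0, by omega⟩, x), fun h => absurd h hx⟩
  choose c hc using hcode
  let T : EuclideanSpace ℝ (Fin n) → EuclideanSpace ℝ (Fin n) := fun x => (c x).2
  let f : EuclideanSpace ℝ (Fin n) → ℝ := fun x => Real.ofDigits (fun k => (c (T^[k] x)).1)
  have hf0 : ∀ x, 0 ≤ f x := fun x => Real.ofDigits_nonneg _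
  have hf1 : ∀ x, f x ≤ 1 := fun x => Real.ofDigits_le_one _
  have hfrec : ∀ x, f x = (((c x).1 : ℕ) + f (T x)) / N := by
    intro x
    have := Real.ofDigits_eq_sum_add_ofDigits (fun k => (c (T^[k] x)).1) 1
    change f x = _ at this
    rw [this]
    simp only [Finset.sum_range_one, Real.ofDigitsTerm, f, Function.iterate_succ_apply,
      Function.iterate_zero_apply, zero_add, pow_one]
    field_simp
  have hcF : ∀ i, ∀ x ∈ K, c (cantorMap n N lam b i x) = (i, x) := by
    intro i x hx
    obtain ⟨h1, h2⟩ := hc _ (hmem i x hx)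
    have hi : (c (cantorMap n N lam b i x)).1 = i := by
      by_contra hne
      have := hdisj _ _ hne
      exact Set.notMem_empty (cantorMap n N lam b i x)
        (this ▸ ⟨⟨_, h1, h2⟩, ⟨x, hx, rfl⟩⟩)
    rw [hi] at h2
    exact Prod.ext hi (hinj i h2)
  have hfF : ∀ i : Fin N, ∀ x ∈ K, f (cantorMap n N lam b i x) = ((i : ℕ) + f x) / N := by
    intro i x hx
    rw [hfrec]
    simp only [T, hcF i x hx]
  -- Hölder
  have hold : ∀ k : ℕ, ∀ x ∈ K, ∀ y ∈ K, δ * lam ^ k ≤ dist x y →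
      |f x - f y| ≤ (dist x y / δ) ^ p := by
    have base : ∀ x ∈ K, ∀ y ∈ K, δ ≤ dist x y → |f x - f y| ≤ (dist x y / δ) ^ p := by
      intro x _ y _ h
      have h1 : |f x - f y| ≤ 1 := by
        rw [abs_le]; constructor <;> linarith [hf0 x, hf0 y, hf1 x, hf1 y]
      exact h1.trans (Real.one_le_rpow ((one_le_div hδ).2 h) hp.le)
    intro k
    induction k with
    | zero => simpa using base
    | succ k ih =>
      intro x hx y hy h
      rcases le_or_gt δ (dist x y) with hle | hlt
      · exact base x hx y hy hle
      obtain ⟨hx1, hx2⟩ := hc x hx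
      obtain ⟨hy1, hy2⟩ := hc y hy
      have heq : (c x).1 = (c y).1 := by
        by_contra hne
        have := hsep _ _ hne _ hx1 _ hy1
        rw [hx2, hy2] at this
        linarith
      have hd : dist x y = lam * dist (T x) (T y) := by
        rw [← hdist (c x).1 (T x) (T y)]
        conv_rhs => rw [hx2, heq, hy2]
      have h' : δ * lam ^ k ≤ dist (T x) (T y) := by
        rw [hd, pow_succ] at h
        nlinarith
      have := ih _ hx1 _ hy1 h'
      rw [hfrec x, hfrec y, heq, hd, mul_div_assoc, Real.mul_rpow hlam0.le (by positivity), hlp,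
        ← sub_div, add_sub_add_left_eq_sub, abs_div, abs_of_pos hN0, div_eq_inv_mul]
      gcongr
  have hH : HolderOnWith (NNReal.mk ((δ⁻¹) ^ p) (by positivity)) (NNReal.mk p hp.le) f K := by
    intro x hx y hy
    rcases eq_or_ne x y with rfl | hxy
    · simp
    have hpos : 0 < dist x y := dist_pos.2 hxy
    obtain ⟨k, hk⟩ := exists_pow_lt_of_lt_one (div_pos hpos hδ) hlam1
    rw [lt_div_iff₀ hδ] at hk
    have := hold k x hx y hy (by linarith)
    rw [div_eq_inv_mul, Real.mul_rpow (by positivity) (by positivity)] at this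
    rw [edist_dist, edist_dist, ← ENNReal.ofReal_eq_coe_nnreal (by positivity), NNReal.coe_mk,
      ENNReal.ofReal_rpow_of_nonneg (by positivity) hp.le, ← ENNReal.ofReal_mul (by positivity)]
    exact ENNReal.ofReal_le_ofReal this
  -- surjectivity
  have hdense : ∀ k : ℕ, ∀ y : ℝ, 0 ≤ y → y ≤ 1 → ∃ x ∈ K, |f x - y| ≤ ((N : ℝ)⁻¹) ^ k := by
    intro k
    induction k with
    | zero =>
      intro y h0 h1
      obtain ⟨x, hx⟩ := hKne
      refine ⟨x, hx, ?_⟩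
      rw [pow_zero, abs_le]; constructor <;> linarith [hf0 x, hf1 x]
    | succ k ih =>
      intro y h0 h1
      obtain ⟨i, hi0, hi1⟩ : ∃ i : Fin N, ((i : ℕ) : ℝ) ≤ N * y ∧ N * y ≤ (i : ℕ) + 1 := by
        rcases h1.eq_or_lt with rfl | h1
        · refine ⟨⟨N - 1, by omega⟩, ?_, ?_⟩
          · simp
          · rw [Nat.cast_sub (by omega)]; simp
        · refine ⟨⟨⌊N * y⌋₊, ?_⟩, Nat.floor_le (by positivity), (Nat.lt_floor_add_one _).le⟩
          rw [Nat.floor_lt (by positivity)]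
          nlinarith
      obtain ⟨x, hx, h⟩ := ih (N * y - (i : ℕ)) (by linarith) (by linarith)
      refine ⟨_, hmem i x hx, ?_⟩
      have : f (cantorMap n N lam b i x) - y = (N : ℝ)⁻¹ * (f x - (N * y - (i : ℕ))) := by
        rw [hfF i x hx]; field_simp; ring
      rw [this, abs_mul, abs_of_pos (inv_pos.2 hN0), pow_succ']
      gcongr
  have hclosed : IsClosed (f '' K) := (hKcpt.image_of_continuousOn (hH.continuousOn hp)).isClosed
  have hsub : Set.Icc (0 : ℝ) 1 ⊆ f '' K := by
    intro y hy
    rw [← hclosed.closure_eq, Metric.mem_closure_iff]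
    intro ε hε
    obtain ⟨k, hk⟩ := exists_pow_lt_of_lt_one hε
      (inv_lt_one_of_one_lt₀ (by exact_mod_cast hN : (1 : ℝ) < N))
    obtain ⟨x, hx, h⟩ := hdense k y hy.1 hy.2
    refine ⟨f x, ⟨x, hx, rfl⟩, ?_⟩
    rw [dist_comm, Real.dist_eq]
    linarith
  have h1 : (1 : ℝ≥0∞) ≤ dimH (f '' K) := by
    have : dimH (Set.Icc (0 : ℝ) 1) = 1 := by
      rw [Real.dimH_of_nonempty_interior (by rw [interior_Icc]; exact ⟨1/2, by norm_num⟩)]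
      simp
    exact this ▸ dimH_mono hsub
  have h2 := h1.trans (hH.dimH_image_le hp)
  rw [ENNReal.ofReal_eq_coe_nnreal hp.le]
  have hp0 : (↑(NNReal.mk p hp.le) : ℝ≥0∞) ≠ 0 :=
    ENNReal.coe_ne_zero.2 (fun h => hp.ne' (congrArg NNReal.toReal h))
  rw [ENNReal.le_div_iff_mul_le (Or.inl hp0) (Or.inl ENNReal.coe_ne_top), one_mul] at h2
  exact h2

/-- Section 4 of the paper: the Hausdorff (and box) dimension of the Cantor-type
self-similar set `K` equals `log N / log (1/λ)`. -/
theorem stmt_9 (n N : ℕ) (hn : 1 ≤ n) (hN : 2 ≤ N) (lam : ℝ) (hlam0 : 0 < lam)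
    (hlam1 : lam < 1) (b : Fin N → EuclideanSpace ℝ (Fin n))
    (K : Set (EuclideanSpace ℝ (Fin n))) (hKne : K.Nonempty) (hKcpt : IsCompact K)
    (hself : K = ⋃ i : Fin N, cantorMap n N lam b i '' K)
    (hdisj : ∀ i j : Fin N, i ≠ j →
      (cantorMap n N lam b i '' K) ∩ (cantorMap n N lam b j '' K) = ∅) :
    dimH K = ENNReal.ofReal (Real.log N / Real.log (1 / lam)) := by
  have hN1 : (1 : ℝ) < N := by exact_mod_cast hN
  have hl : 0 < Real.log (1 / lam) := Real.log_pos ((one_lt_div hlam0).2 hlam1)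
  have hp : 0 < Real.log N / Real.log (1 / lam) := div_pos (Real.log_pos hN1) hl
  have hlp : lam ^ (Real.log N / Real.log (1 / lam)) = (N : ℝ)⁻¹ := by
    have h0 : Real.log lam ≠ 0 := (Real.log_neg hlam0 hlam1).ne
    rw [Real.rpow_def_of_pos hlam0, one_div, Real.log_inv,
      show Real.log lam * (Real.log N / -Real.log lam) = -Real.log N by field_simp,
      Real.exp_neg, Real.exp_log (by linarith)]
  have hdist : ∀ i x y,
      dist (cantorMap n N lam b i x) (cantorMap n N lam b i y) = lam * dist x y := by
    intro i x y
    simp only [cantorMap, dist_add_right, dist_smul₀, dist_sub_right, Real.norm_eq_abs,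
      abs_of_pos hlam0]
  exact le_antisymm
    (aux_upper n N lam _ hlam0 hlam1 hp hlp hN b K hKcpt hself hdist)
    (aux_lower n N lam _ hlam0 hlam1 hp hlp hN b K hKne hKcpt hself hdisj hdist)
end

section
/- In the self-similar Cantor-type setting, the restriction of H_p to K is Ahlfors regular of dimension p: there exists a constant C ≥ 1 such that for every x ∈ K and every real r with 0 < r ≤ 1, C^{-1} · r^p ≤ H_p(K ∩ closedBall(x, r)) ≤ C · r^p, where p = log N / log(1/λ). -/
open MeasureTheory
open scoped ENNReal

section helpers

variable {n N : ℕ} {lam : ℝ} {b : Fin N → EuclideanSpace ℝ (Fin n)}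
  {K : Set (EuclideanSpace ℝ (Fin n))}

lemma aux_dist (hlam0 : 0 < lam) (i : Fin N) (x y : EuclideanSpace ℝ (Fin n)) :
    dist (cantorMap n N lam b i x) (cantorMap n N lam b i y) = lam * dist x y := by
  unfold cantorMap
  rw [dist_add_right, dist_smul₀, dist_sub_right, Real.norm_of_nonneg hlam0.le]

lemma aux_inj (hlam0 : 0 < lam) (i : Fin N) : Function.Injective (cantorMap n N lam b i) := by
  intro x y h
  have := aux_dist (b := b) hlam0 i x y
  rw [h, dist_self] at this
  have h2 : dist x y = 0 := by
    rcases mul_eq_zero.1 this.symm with h | h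
    · exact absurd h hlam0.ne'
    · exact h
  exact dist_eq_zero.1 h2

lemma aux_cont (i : Fin N) : Continuous (cantorMap n N lam b i) := by
  unfold cantorMap
  fun_prop

lemma aux_cell_cons (i : Fin N) (w : List (Fin N)) :
    cantorCell n N lam b K (i :: w) = cantorMap n N lam b i '' cantorCell n N lam b K w := by
  unfold cantorCell
  rw [← Set.image_comp]
  rfl

lemma aux_cell_nil : cantorCell n N lam b K [] = K := by
  unfold cantorCell cantorMapWord
  simp

lemma aux_cell_compact (hK : IsCompact K) (w : List (Fin N)) :
    IsCompact (cantorCell n N lam b K w) := by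
  induction w with
  | nil => rwa [aux_cell_nil]
  | cons i w ih => rw [aux_cell_cons]; exact ih.image (aux_cont i)

lemma aux_cell_nonempty (hK : K.Nonempty) (w : List (Fin N)) :
    (cantorCell n N lam b K w).Nonempty := by
  unfold cantorCell
  exact hK.image _

lemma aux_sub (hself : K = ⋃ i : Fin N, cantorMap n N lam b i '' K) (i : Fin N) :
    cantorMap n N lam b i '' K ⊆ K := by
  conv_rhs => rw [hself]
  exact Set.subset_iUnion (fun i : Fin N => cantorMap n N lam b i '' K) i

lemma aux_cell_append (hself : K = ⋃ i : Fin N, cantorMap n N lam b i '' K)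
    (w v : List (Fin N)) :
    cantorCell n N lam b K (w ++ v) ⊆ cantorCell n N lam b K w := by
  induction w with
  | nil =>
    rw [aux_cell_nil, List.nil_append]
    induction v with
    | nil => rw [aux_cell_nil]
    | cons i v ih =>
      rw [aux_cell_cons]
      exact (Set.image_mono ih).trans (aux_sub hself i)
  | cons i w ih =>
    rw [List.cons_append, aux_cell_cons, aux_cell_cons]
    exact Set.image_mono ih

lemma aux_cell_sub (hself : K = ⋃ i : Fin N, cantorMap n N lam b i '' K)
    (w : List (Fin N)) : cantorCell n N lam b K w ⊆ K := by
  have := aux_cell_append (lam := lam) (b := b) hself [] w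
  rwa [aux_cell_nil] at this

lemma aux_cell_disj (hlam0 : 0 < lam) (hself : K = ⋃ i : Fin N, cantorMap n N lam b i '' K)
    (hdisj : ∀ i j : Fin N, i ≠ j →
      (cantorMap n N lam b i '' K) ∩ (cantorMap n N lam b j '' K) = ∅)
    (w v : List (Fin N)) (hl : w.length = v.length) (x : EuclideanSpace ℝ (Fin n))
    (hw : x ∈ cantorCell n N lam b K w) (hv : x ∈ cantorCell n N lam b K v) : w = v := by
  induction w generalizing v x with
  | nil => exact (List.length_eq_zero_iff.1 hl.symm).symm
  | cons i w ih =>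
    cases v with
    | nil => simp at hl
    | cons j v =>
      rw [aux_cell_cons] at hw hv
      obtain ⟨y, hy, rfl⟩ := hw
      obtain ⟨z, hz, hzy⟩ := hv
      have hij : i = j := by
        by_contra hne
        have : cantorMap n N lam b i y ∈
            (cantorMap n N lam b i '' K) ∩ (cantorMap n N lam b j '' K) :=
          ⟨⟨y, aux_cell_sub hself w hy, rfl⟩, ⟨z, aux_cell_sub hself v hz, hzy⟩⟩
        rw [hdisj i j hne] at this
        exact this
      subst hij
      have := aux_inj hlam0 i hzy
      subst this
      rw [ih v (by simpa using hl) _ hy hz]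

lemma aux_cell_exists (hself : K = ⋃ i : Fin N, cantorMap n N lam b i '' K)
    (k : ℕ) (x : EuclideanSpace ℝ (Fin n)) (hx : x ∈ K) :
    ∃ w : List (Fin N), w.length = k ∧ x ∈ cantorCell n N lam b K w := by
  induction k generalizing x with
  | zero => exact ⟨[], rfl, by rwa [aux_cell_nil]⟩
  | succ k ih =>
    rw [hself] at hx
    obtain ⟨i, y, hy, rfl⟩ := Set.mem_iUnion.1 hx
    obtain ⟨w, hw, hyw⟩ := ih y hy
    exact ⟨i :: w, by simp [hw], by rw [aux_cell_cons]; exact ⟨y, hyw, rfl⟩⟩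

lemma aux_cell_dist (hlam0 : 0 < lam) {D : ℝ} (hD : ∀ x ∈ K, ∀ y ∈ K, dist x y ≤ D)
    (w : List (Fin N)) : ∀ x ∈ cantorCell n N lam b K w, ∀ y ∈ cantorCell n N lam b K w,
      dist x y ≤ lam ^ w.length * D := by
  induction w with
  | nil => rw [aux_cell_nil]; simpa using hD
  | cons i w ih =>
    rw [aux_cell_cons]
    rintro _ ⟨x, hx, rfl⟩ _ ⟨y, hy, rfl⟩
    rw [aux_dist hlam0, List.length_cons, pow_succ', mul_assoc]
    exact mul_le_mul_of_nonneg_left (ih x hx y hy) hlam0.le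

lemma aux_cell_measure (hlam0 : 0 < lam) {p : ℝ} (hp : 0 ≤ p) (w : List (Fin N)) :
    μH[p] (cantorCell n N lam b K w) = ENNReal.ofReal ((lam ^ w.length) ^ p) * μH[p] K := by
  induction w with
  | nil => rw [aux_cell_nil]; simp
  | cons i w ih =>
    have h1 : cantorMap n N lam b i = AffineMap.homothety (b i) lam := by
      ext1 x
      simp [cantorMap, AffineMap.homothety_apply]
    rw [aux_cell_cons, h1, hausdorffMeasure_homothety_image hp _ hlam0.ne', ih,
      ENNReal.smul_def, smul_eq_mul, ← mul_assoc]
    congr 1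
    rw [List.length_cons, pow_succ', Real.mul_rpow hlam0.le (by positivity),
      ENNReal.ofReal_mul (by positivity)]
    congr 1
    rw [← ENNReal.ofReal_coe_nnreal]
    congr 1
    rw [NNReal.coe_rpow, coe_nnnorm, Real.norm_of_nonneg hlam0.le]

lemma aux_sep (hKcpt : IsCompact K)
    (hdisj : ∀ i j : Fin N, i ≠ j →
      (cantorMap n N lam b i '' K) ∩ (cantorMap n N lam b j '' K) = ∅) :
    ∃ δ : ℝ, 0 < δ ∧ ∀ i j : Fin N, ∀ x ∈ cantorMap n N lam b i '' K,
      ∀ y ∈ cantorMap n N lam b j '' K, dist x y ≤ δ → i = j := by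
  have h1 : ∀ q : Fin N × Fin N, ∃ δ : ℝ, 0 < δ ∧ ∀ x ∈ cantorMap n N lam b q.1 '' K,
      ∀ y ∈ cantorMap n N lam b q.2 '' K, dist x y ≤ δ → q.1 = q.2 := by
    rintro ⟨i, j⟩
    by_cases hij : i = j
    · exact ⟨1, one_pos, fun _ _ _ _ _ => hij⟩
    · obtain ⟨r, hr, h⟩ := Metric.exists_pos_forall_lt_edist
        (hKcpt.image (aux_cont (lam := lam) (b := b) i))
        (hKcpt.image (aux_cont (lam := lam) (b := b) j)).isClosed
        (Set.disjoint_iff_inter_eq_empty.2 (hdisj i j hij))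
      refine ⟨r, hr, fun x hx y hy hd => ?_⟩
      exfalso
      have h2 := h x hx y hy
      rw [edist_nndist, ENNReal.coe_lt_coe, ← NNReal.coe_lt_coe, coe_nndist] at h2
      exact absurd hd (not_le.2 h2)
  choose f hf0 hf using h1
  rcases isEmpty_or_nonempty (Fin N × Fin N) with he | he
  · exact ⟨1, one_pos, fun i j => (he.false (i, j)).elim⟩
  · obtain ⟨q, hq⟩ := Finite.exists_min f
    exact ⟨f q, hf0 q, fun i j x hx y hy hd => hf (i, j) x hx y hy (hd.trans (hq _))⟩

lemma aux_one_cell (hN : 2 ≤ N) (hlam0 : 0 < lam)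
    (hself : K = ⋃ i : Fin N, cantorMap n N lam b i '' K) {δ : ℝ}
    (hδ : ∀ i j : Fin N, ∀ x ∈ cantorMap n N lam b i '' K,
      ∀ y ∈ cantorMap n N lam b j '' K, dist x y ≤ δ → i = j) (k : ℕ)
    (hlam1 : lam < 1) (hδ0 : 0 < δ)
    (s : Set (EuclideanSpace ℝ (Fin n))) (hsK : s ⊆ K)
    (hs : ∀ x ∈ s, ∀ y ∈ s, dist x y ≤ lam ^ k * δ) :
    ∃ w : List (Fin N), w.length = k + 1 ∧ s ⊆ cantorCell n N lam b K w := by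
  have hle : ∀ k : ℕ, lam ^ k * δ ≤ δ := fun k =>
    mul_le_of_le_one_left hδ0.le (pow_le_one₀ hlam0.le hlam1.le)
  rcases s.eq_empty_or_nonempty with rfl | ⟨x0, hx0⟩
  · exact ⟨List.replicate (k + 1) ⟨0, by omega⟩, by simp, by simp⟩
  induction k generalizing s x0 with
  | zero =>
    have hx := hsK hx0
    rw [hself] at hx
    obtain ⟨i, hi⟩ := Set.mem_iUnion.1 hx
    refine ⟨[i], rfl, fun y hy => ?_⟩
    have hy' := hsK hy
    rw [hself] at hy'
    obtain ⟨j, hj⟩ := Set.mem_iUnion.1 hy'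
    have := hδ i j _ hi _ hj ((hs _ hx0 _ hy).trans (hle _))
    subst this
    rwa [aux_cell_cons, aux_cell_nil]
  | succ k ih =>
    have hx := hsK hx0
    rw [hself] at hx
    obtain ⟨i, hi⟩ := Set.mem_iUnion.1 hx
    have hsi : ∀ y ∈ s, y ∈ cantorMap n N lam b i '' K := fun y hy => by
      have hy' := hsK hy
      rw [hself] at hy'
      obtain ⟨j, hj⟩ := Set.mem_iUnion.1 hy'
      have := hδ i j _ hi _ hj ((hs _ hx0 _ hy).trans (hle _))
      subst this
      exact hj
    obtain ⟨z0, hz0, hz0x⟩ := hi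
    obtain ⟨w, hw, hsub⟩ := ih (K ∩ cantorMap n N lam b i ⁻¹' s) Set.inter_subset_left
      (fun x hx y hy => by
        have := hs _ hx.2 _ hy.2
        rw [aux_dist hlam0, pow_succ', mul_assoc] at this
        exact le_of_mul_le_mul_left this hlam0) z0 ⟨hz0, by simpa [hz0x] using hx0⟩
    refine ⟨i :: w, by simp [hw], fun y hy => ?_⟩
    rw [aux_cell_cons]
    obtain ⟨z, hz, rfl⟩ := hsi y hy
    exact ⟨z, hsub ⟨hz, hy⟩, rfl⟩

lemma aux_small (hN : 2 ≤ N) (hlam0 : 0 < lam) (hlam1 : lam < 1) (hKcpt : IsCompact K)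
    (hself : K = ⋃ i : Fin N, cantorMap n N lam b i '' K)
    (hdisj : ∀ i j : Fin N, i ≠ j →
      (cantorMap n N lam b i '' K) ∩ (cantorMap n N lam b j '' K) = ∅) :
    ∃ M : ℝ, 0 < M ∧ ∀ s : Set (EuclideanSpace ℝ (Fin n)), s ⊆ K → ∀ r : ℝ, 0 < r →
      (∀ x ∈ s, ∀ y ∈ s, dist x y ≤ r) →
      ∃ w : List (Fin N), s ⊆ cantorCell n N lam b K w ∧ lam ^ w.length ≤ M * r := by
  obtain ⟨δ, hδ0, hδ⟩ := aux_sep hKcpt hdisj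
  refine ⟨δ⁻¹, by positivity, fun s hsK r hr hs => ?_⟩
  rcases le_total (δ⁻¹ * r) 1 with h | h
  · obtain ⟨k, hk1, hk2⟩ := exists_nat_pow_near_of_lt_one (by positivity) h hlam0 hlam1
    obtain ⟨w, hw, hsw⟩ := aux_one_cell hN hlam0 hself hδ k hlam1 hδ0 s hsK
      (fun x hx y hy => (hs x hx y hy).trans (by
        rw [inv_mul_eq_div, div_le_iff₀ hδ0] at hk2; exact hk2))
    exact ⟨w, hsw, by rw [hw]; exact hk1.le⟩
  · exact ⟨[], by rwa [aux_cell_nil], by simpa using h⟩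

lemma aux_finite (hN : 2 ≤ N) (hlam0 : 0 < lam) (hlam1 : lam < 1) (hKcpt : IsCompact K)
    (hself : K = ⋃ i : Fin N, cantorMap n N lam b i '' K) {p : ℝ} (hp : 0 < p)
    (hlp : lam ^ p = (N : ℝ)⁻¹) : μH[p] K < ⊤ := by
  obtain ⟨D, hD⟩ := Metric.isBounded_iff.1 hKcpt.isBounded
  have hD : ∀ x ∈ K, ∀ y ∈ K, dist x y ≤ max D 0 :=
    fun x hx y hy => (hD hx hy).trans (le_max_left _ _)
  generalize hD' : max D 0 = D' at hD
  have hD0 : 0 ≤ D' := hD' ▸ le_max_right _ _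
  have hdiam : ∀ (k : ℕ) (i : Fin k → Fin N),
      Metric.ediam (cantorCell n N lam b K (List.ofFn i)) ≤ ENNReal.ofReal (lam ^ k * D') := by
    intro k i
    refine Metric.ediam_le fun x hx y hy => ?_
    rw [edist_dist]
    have := aux_cell_dist hlam0 hD (List.ofFn i) x hx y hy
    rw [List.length_ofFn] at this
    exact ENNReal.ofReal_le_ofReal this
  have key := Measure.hausdorffMeasure_le_liminf_sum (ι := fun k : ℕ => (Fin k → Fin N)) p K
    (l := Filter.atTop) (fun k : ℕ => ENNReal.ofReal (lam ^ k * D'))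
    (by
      have h1 : Filter.Tendsto (fun k : ℕ => lam ^ k * D') Filter.atTop (nhds (0 * D')) :=
        (tendsto_pow_atTop_nhds_zero_of_lt_one hlam0.le hlam1).mul_const _
      rw [zero_mul] at h1
      simpa using ENNReal.tendsto_ofReal h1)
    (fun k i => cantorCell n N lam b K (List.ofFn i))
    (Filter.Eventually.of_forall hdiam)
    (Filter.Eventually.of_forall fun k x hx => by
      obtain ⟨w, hw, hxw⟩ := aux_cell_exists hself k x hx
      subst hw
      exact Set.mem_iUnion.2 ⟨w.get, by rwa [List.ofFn_get]⟩)
  have hbd : ∀ k : ℕ, ∑ i : Fin k → Fin N,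
      Metric.ediam (cantorCell n N lam b K (List.ofFn i)) ^ p ≤ ENNReal.ofReal (D' ^ p) := by
    intro k
    calc _ ≤ ∑ i : Fin k → Fin N, ENNReal.ofReal ((lam ^ k * D') ^ p) := by
          refine Finset.sum_le_sum fun i _ => ?_
          rw [← ENNReal.ofReal_rpow_of_nonneg (by positivity) hp.le]
          exact ENNReal.rpow_le_rpow (hdiam k i) hp.le
      _ = ENNReal.ofReal (D' ^ p) := by
          rw [Finset.sum_const, Finset.card_univ, Fintype.card_fun, Fintype.card_fin,
            Fintype.card_fin, nsmul_eq_mul, Real.mul_rpow (by positivity) hD0,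
            ← Real.rpow_natCast lam k, ← Real.rpow_mul hlam0.le, mul_comm (k : ℝ) p,
            Real.rpow_mul hlam0.le, hlp, Real.rpow_natCast]
          rw [← ENNReal.ofReal_natCast, ← ENNReal.ofReal_mul (by positivity)]
          congr 1
          push_cast
          have : (N : ℝ) ≠ 0 := by positivity
          rw [← mul_assoc, ← mul_pow, mul_inv_cancel₀ this, one_pow, one_mul]
  refine lt_of_le_of_lt (key.trans ?_) (ENNReal.ofReal_lt_top (r := D' ^ p))
  refine Filter.liminf_le_of_le (by isBoundedDefault) fun c hc => ?_
  obtain ⟨k, hk⟩ := hc.exists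
  exact hk.trans (hbd k)

lemma aux_prob (hN : 2 ≤ N) : ∃ P : Measure (ℕ → Fin N), P Set.univ = 1 ∧
    ∀ (k : ℕ) (w : List (Fin N)), P {σ | (List.range k).map σ = w} ≤ ((N : ℝ≥0∞)⁻¹) ^ k := by
  have hpr : IsProbabilityMeasure ((N : ℝ≥0∞)⁻¹ • (Measure.count : Measure (Fin N))) := by
    constructor
    simp only [Measure.smul_apply, smul_eq_mul, Measure.count_univ]
    simp
    exact ENNReal.inv_mul_cancel (by simp; omega) (by simp)
  refine ⟨Measure.infinitePi fun _ => ((N : ℝ≥0∞)⁻¹ • (Measure.count : Measure (Fin N))),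
    measure_univ, fun k w => ?_⟩
  rcases Set.eq_empty_or_nonempty {σ : ℕ → Fin N | (List.range k).map σ = w} with h | ⟨σ0, h0⟩
  · rw [h]; simp
  · have hsub : {σ : ℕ → Fin N | (List.range k).map σ = w} ⊆
        Set.pi (Finset.range k) (fun i => {σ0 i}) := by
      intro σ hσ i hi
      have h1 : (List.range k).map σ = (List.range k).map σ0 := hσ.trans h0.symm
      exact List.map_inj_left.1 h1 i (by simpa using hi)
    refine (measure_mono hsub).trans ?_
    rw [Measure.infinitePi_pi _ (fun i _ => measurableSet_singleton _)]
    simp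

lemma aux_pos (hN : 2 ≤ N) (hlam0 : 0 < lam) (hlam1 : lam < 1) (hKne : K.Nonempty)
    (hKcpt : IsCompact K)
    (hself : K = ⋃ i : Fin N, cantorMap n N lam b i '' K)
    (hdisj : ∀ i j : Fin N, i ≠ j →
      (cantorMap n N lam b i '' K) ∩ (cantorMap n N lam b j '' K) = ∅) {p : ℝ} (hp : 0 < p)
    (hlp : lam ^ p = (N : ℝ)⁻¹) : 0 < μH[p] K := by
  obtain ⟨M, hM, hsm⟩ := aux_small hN hlam0 hlam1 hKcpt hself hdisj
  obtain ⟨P, hP1, hPc⟩ := aux_prob hN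
  have hex : ∀ σ : ℕ → Fin N, ∃ x, ∀ k : ℕ,
      x ∈ cantorCell n N lam b K ((List.range k).map σ) := by
    intro σ
    have := IsCompact.nonempty_iInter_of_sequence_nonempty_isCompact_isClosed
      (fun k : ℕ => cantorCell n N lam b K ((List.range k).map σ))
      (fun k => by
        rw [List.range_succ, List.map_append]
        exact aux_cell_append hself _ _)
      (fun k => aux_cell_nonempty hKne _) (aux_cell_compact hKcpt _)
      (fun k => (aux_cell_compact hKcpt _).isClosed)
    obtain ⟨x, hx⟩ := this
    exact ⟨x, fun k => Set.mem_iInter.1 hx k⟩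
  choose f hf using hex
  have hfK : ∀ σ, f σ ∈ K := fun σ => aux_cell_sub hself _ (hf σ 0)
  have hpow : ∀ k : ℕ, ((N : ℝ≥0∞)⁻¹) ^ k = ENNReal.ofReal ((lam ^ k) ^ p) := by
    intro k
    rw [← Real.rpow_natCast lam k, ← Real.rpow_mul hlam0.le, mul_comm (k : ℝ) p,
      Real.rpow_mul hlam0.le, hlp, Real.rpow_natCast, ENNReal.ofReal_pow (by positivity),
      ENNReal.ofReal_inv_of_pos (by positivity), ENNReal.ofReal_natCast]
  have hbound : ∀ s : Set (EuclideanSpace ℝ (Fin n)), ∀ r : ℝ, 0 < r →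
      (∀ x ∈ s, ∀ y ∈ s, dist x y ≤ r) → P (f ⁻¹' s) ≤ ENNReal.ofReal ((M * r) ^ p) := by
    intro s r hr hs
    obtain ⟨w, hw, hwr⟩ := hsm (s ∩ K) Set.inter_subset_right r hr
      (fun x hx y hy => hs x hx.1 y hy.1)
    calc P (f ⁻¹' s) ≤ P {σ | (List.range w.length).map σ = w} := by
          refine measure_mono fun σ hσ => ?_
          exact aux_cell_disj hlam0 hself hdisj _ _ (by simp) _ (hf σ w.length)
            (hw ⟨hσ, hfK σ⟩)
      _ ≤ _ := hPc _ _
      _ = _ := hpow _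
      _ ≤ _ := ENNReal.ofReal_le_ofReal (Real.rpow_le_rpow (by positivity) hwr hp.le)
  set c : ℝ≥0∞ := ENNReal.ofReal (M ^ p) with hc
  have hc0 : c ≠ 0 := by
    rw [hc]; simp; positivity
  have hct : c ≠ ⊤ := ENNReal.ofReal_ne_top
  have hle : c⁻¹ • OuterMeasure.map f P.toOuterMeasure ≤
      OuterMeasure.mkMetric (fun r : ℝ≥0∞ => r ^ p) := by
    refine OuterMeasure.le_mkMetric _ _ 1 one_pos fun s hs => ?_
    have hst : Metric.ediam s ≠ ⊤ := ne_top_of_le_ne_top ENNReal.one_ne_top hs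
    have h1 : P (f ⁻¹' s) ≤ ENNReal.ofReal ((M * (Metric.ediam s).toReal) ^ p) := by
      have ht : Filter.Tendsto (fun r : ℝ => ENNReal.ofReal ((M * r) ^ p))
          (nhdsWithin (Metric.ediam s).toReal (Set.Ioi (Metric.ediam s).toReal))
          (nhds (ENNReal.ofReal ((M * (Metric.ediam s).toReal) ^ p))) := by
        refine Filter.Tendsto.mono_left ?_ nhdsWithin_le_nhds
        refine ENNReal.tendsto_ofReal ?_
        refine Filter.Tendsto.rpow_const ?_ (Or.inr hp.le)
        exact (continuous_const.mul continuous_id).tendsto _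
      refine ge_of_tendsto ht ?_
      filter_upwards [self_mem_nhdsWithin] with r hr
      have hr' : (Metric.ediam s).toReal < r := hr
      refine hbound s r (ENNReal.toReal_nonneg.trans_lt hr') fun x hx y hy => ?_
      refine le_trans ?_ hr'.le
      rw [dist_edist]
      exact ENNReal.toReal_mono hst (Metric.edist_le_ediam_of_mem hx hy)
    have h2 : ENNReal.ofReal ((M * (Metric.ediam s).toReal) ^ p) = c * Metric.ediam s ^ p := by
      rw [Real.mul_rpow hM.le ENNReal.toReal_nonneg, ENNReal.ofReal_mul (by positivity),
        ← ENNReal.ofReal_rpow_of_nonneg ENNReal.toReal_nonneg hp.le, ENNReal.ofReal_toReal hst]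
    rw [h2] at h1
    change c⁻¹ * P (f ⁻¹' s) ≤ Metric.ediam s ^ p
    calc c⁻¹ * P (f ⁻¹' s) ≤ c⁻¹ * (c * Metric.ediam s ^ p) := by gcongr
      _ = _ := by rw [← mul_assoc, ENNReal.inv_mul_cancel hc0 hct, one_mul]
  have h3 : c⁻¹ * P (f ⁻¹' K) ≤ μH[p] K := by
    have := hle K
    rw [← Measure.mkMetric_toOuterMeasure] at this
    exact this
  have h4 : f ⁻¹' K = Set.univ := Set.eq_univ_of_forall hfK
  rw [h4, hP1, mul_one] at h3
  exact lt_of_lt_of_le (ENNReal.inv_pos.2 hct) h3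

end helpers

/-- Section 5 of the paper: the restriction of the `p`-Hausdorff measure to `K` is
Ahlfors regular of dimension `p = log N / log (1/λ)`:
`C⁻¹·r^p ≤ H_p(K ∩ B̄(x,r)) ≤ C·r^p` for `x ∈ K` and `0 < r ≤ 1`. -/
theorem stmt_15 (n N : ℕ) (hn : 1 ≤ n) (hN : 2 ≤ N) (lam : ℝ) (hlam0 : 0 < lam)
    (hlam1 : lam < 1) (b : Fin N → EuclideanSpace ℝ (Fin n))
    (K : Set (EuclideanSpace ℝ (Fin n))) (hKne : K.Nonempty) (hKcpt : IsCompact K)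
    (hself : K = ⋃ i : Fin N, cantorMap n N lam b i '' K)
    (hdisj : ∀ i j : Fin N, i ≠ j →
      (cantorMap n N lam b i '' K) ∩ (cantorMap n N lam b j '' K) = ∅)
    (p : ℝ) (hp : p = Real.log N / Real.log (1 / lam)) :
    ∃ C : ℝ, 1 ≤ C ∧ ∀ x ∈ K, ∀ r : ℝ, 0 < r → r ≤ 1 →
      ENNReal.ofReal (C⁻¹ * r ^ p) ≤ μH[p] (K ∩ Metric.closedBall x r) ∧
      μH[p] (K ∩ Metric.closedBall x r) ≤ ENNReal.ofReal (C * r ^ p) := by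
  have hN1 : (1 : ℝ) < N := by exact_mod_cast (by omega : 1 < N)
  have hlogN : 0 < Real.log N := Real.log_pos hN1
  have hlogl : 0 < Real.log (1 / lam) := Real.log_pos (by rw [one_div]; exact (one_lt_inv₀ hlam0).2 hlam1)
  have hp0 : 0 < p := by rw [hp]; positivity
  have hlp : lam ^ p = (N : ℝ)⁻¹ := by
    have h1 : Real.log lam * p = -Real.log N := by
      rw [hp]
      rw [one_div, Real.log_inv] at hlogl ⊢
      have : Real.log lam ≠ 0 := by linarith
      field_simp
    rw [Real.rpow_def_of_pos hlam0, h1, Real.exp_neg, Real.exp_log (by linarith)]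
  have hfin := aux_finite hN hlam0 hlam1 hKcpt hself hp0 hlp
  have hpos := aux_pos hN hlam0 hlam1 hKne hKcpt hself hdisj hp0 hlp
  obtain ⟨M, hM, hsm⟩ := aux_small hN hlam0 hlam1 hKcpt hself hdisj
  obtain ⟨D0, hD0⟩ := Metric.isBounded_iff.1 hKcpt.isBounded
  obtain ⟨D, hD1, hD⟩ : ∃ D : ℝ, 1 ≤ D ∧ ∀ x ∈ K, ∀ y ∈ K, dist x y ≤ D :=
    ⟨max D0 1, le_max_right _ _, fun x hx y hy => (hD0 hx hy).trans (le_max_left _ _)⟩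
  have hDpos : 0 < D := by linarith
  obtain ⟨h, hh0, hh⟩ : ∃ h : ℝ, 0 < h ∧ μH[p] K = ENNReal.ofReal h :=
    ⟨(μH[p] K).toReal, ENNReal.toReal_pos hpos.ne' hfin.ne, (ENNReal.ofReal_toReal hfin.ne).symm⟩
  set A : ℝ := (M * 2) ^ p * h with hA
  set B : ℝ := (lam / D) ^ p * h with hB
  have hBpos : 0 < B := by positivity
  have hC1 : 1 ≤ max 1 (max A B⁻¹) := le_max_left _ _
  have hCA : A ≤ max 1 (max A B⁻¹) := (le_max_left _ _).trans (le_max_right _ _)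
  have hCB : B⁻¹ ≤ max 1 (max A B⁻¹) := (le_max_right _ _).trans (le_max_right _ _)
  generalize max 1 (max A B⁻¹) = C at hC1 hCA hCB
  refine ⟨C, hC1, fun x hx r hr hr1 => ⟨?_, ?_⟩⟩
  · have hCB' : C⁻¹ ≤ B := inv_le_of_inv_le₀ hBpos hCB
    obtain ⟨k, hk1, hk2⟩ := exists_nat_pow_near_of_lt_one (x := r / D) (by positivity)
      ((div_le_one hDpos).2 (hr1.trans hD1)) hlam0 hlam1
    obtain ⟨w, hw, hxw⟩ := aux_cell_exists hself (k + 1) x hx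
    have hsub : cantorCell n N lam b K w ⊆ K ∩ Metric.closedBall x r := by
      intro y hy
      refine ⟨aux_cell_sub hself w hy, ?_⟩
      have h1 := aux_cell_dist hlam0 hD w y hy x hxw
      rw [hw] at h1
      rw [Metric.mem_closedBall]
      exact h1.trans ((lt_div_iff₀ hDpos).1 hk1).le
    refine le_trans ?_ (measure_mono hsub)
    rw [aux_cell_measure hlam0 hp0.le, hh, hw, ← ENNReal.ofReal_mul (by positivity)]
    refine ENNReal.ofReal_le_ofReal ?_
    calc C⁻¹ * r ^ p ≤ B * r ^ p := by gcongr
      _ = (lam * (r / D)) ^ p * h := by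
          rw [hB, show lam * (r / D) = lam / D * r by ring,
            Real.mul_rpow (by positivity) hr.le]
          ring
      _ ≤ (lam ^ (k + 1)) ^ p * h := by
          rw [pow_succ']
          gcongr
  · obtain ⟨w, hw, hwr⟩ := hsm (K ∩ Metric.closedBall x r) Set.inter_subset_left (2 * r)
      (by positivity) (fun y hy z hz => by
        have h1 := Metric.mem_closedBall.1 hy.2
        have h2 := Metric.mem_closedBall.1 hz.2
        have := dist_triangle_right y z x
        linarith)
    refine (measure_mono hw).trans ?_
    rw [aux_cell_measure hlam0 hp0.le, hh, ← ENNReal.ofReal_mul (by positivity)]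
    refine ENNReal.ofReal_le_ofReal ?_
    calc (lam ^ w.length) ^ p * h ≤ (M * (2 * r)) ^ p * h := by gcongr
      _ = A * r ^ p := by
          rw [hA, ← mul_assoc, Real.mul_rpow (by positivity) hr.le]
          ring
      _ ≤ C * r ^ p := by gcongr
end
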